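/- Let K be an arbitrary field and let n ≥ 3. There is no K-linear subspace A of the matrix algebra K^{n,n} that is closed under matrix multiplication and has dimension exactly n² − 1 over K. -/

import Mathlib

/-- On `n × n` matrices with `n ≥ 3`, the kernel of a nonzero linear functional is not closed under
multiplication. -/
theorem not_mul_mem_ker {K : Type*} [Field K] {n : ℕ} (hn : 3 ≤ n)
    {φ : Matrix (Fin n) (Fin n) K →ₗ[K] K} (hφ : φ ≠ 0) :
    ¬ ∀ x ∈ φ.ker, ∀ y ∈ φ.ker, x * y ∈ φ.ker := by
  intro hmul
  obtain ⟨i, j, hij⟩ : ∃ i j, φ (Matrix.single i j 1) ≠ 0 := by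
    by_contra! h
    refine hφ (Matrix.ext_linearMap K fun i j => LinearMap.ext_ring ?_)
    simpa using h i j
  let row : (Fin n → K) →ₗ[K] Matrix (Fin n) (Fin n) K :=
    { toFun := Matrix.vecMulVec (Pi.single i 1)
      map_add' := Matrix.vecMulVec_add _
      map_smul' := fun c v => Matrix.vecMulVec_smul c _ v }
  have row_mul (v : Fin n → K) (k : Fin n) :
      row v * Matrix.single k j 1 = v k • Matrix.single i j 1 := by
    ext a b
    simp [row, Matrix.mul_apply, Matrix.vecMulVec_apply, Matrix.single_apply, Pi.single_apply,
      ite_and]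
    grind
  -- A nonzero matrix supported on row `i` satisfying two linear conditions.
  let g : (Fin n → K) →ₗ[K] K × K :=
    (φ ∘ₗ row).prod (φ ∘ₗ LinearMap.mulRight K (Matrix.single i j 1) ∘ₗ row)
  obtain ⟨v, hv, hv0⟩ := Submodule.exists_mem_ne_zero_of_ne_bot
    (LinearMap.ker_ne_bot_of_finrank_lt (f := g) (by simp; omega))
  obtain ⟨h1, h2⟩ : φ (row v) = 0 ∧ φ (row v * Matrix.single i j 1) = 0 := by
    simpa [g] using hv
  have hann (y : Matrix (Fin n) (Fin n) K) : φ (row v * y) = 0 := by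
    have := hmul (row v) h1 (y - (φ y / φ (Matrix.single i j 1)) • Matrix.single i j 1)
      (by rw [LinearMap.mem_ker, map_sub, map_smul, smul_eq_mul, div_mul_cancel₀ _ hij, sub_self])
    rwa [LinearMap.mem_ker, mul_sub, mul_smul_comm, map_sub, map_smul, h2, smul_zero, sub_zero]
      at this
  refine hv0 (funext fun k => ?_)
  have := hann (Matrix.single k j 1)
  rw [row_mul, map_smul, smul_eq_mul] at this
  exact (mul_eq_zero.1 this).resolve_right hij

theorem stmt_1 (K : Type*) [Field K] (n : ℕ) (hn : 3 ≤ n) :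
    ¬ ∃ A : Submodule K (Matrix (Fin n) (Fin n) K),
      (∀ x ∈ A, ∀ y ∈ A, x * y ∈ A) ∧ Module.finrank K A = n ^ 2 - 1 := by
  rintro ⟨A, hmul, hdim⟩
  have hpos : 0 < n ^ 2 := by positivity
  have hfin : Module.finrank K (Matrix (Fin n) (Fin n) K) = n ^ 2 := by
    simp [Module.finrank_matrix, sq]
  have hlt : A < ⊤ := lt_top_iff_ne_top.2 fun h => by
    rw [h, finrank_top, hfin] at hdim
    omega
  obtain ⟨φ, hφ, hle⟩ := A.exists_le_ker_of_lt_top hlt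
  have hker : A = φ.ker := Submodule.eq_of_le_of_finrank_le hle <| by
    have := Submodule.finrank_lt (mt LinearMap.ker_eq_top.1 hφ)
    omega
  subst hker
  exact not_mul_mem_ker hn hφ hmul
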